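/- The ESCI bound is tighter than the SCI bound in the common-noise setting. Let ω lie in the unit simplex of R^N with ω_i > 0 for all i, let P_1^{(1)}, …, P_N^{(1)} be positive definite d × d matrices, P_1^{(ind)}, …, P_N^{(ind)} positive semidefinite d × d matrices, Q a positive definite q × q matrix, and M_1, …, M_N d × q matrices with vertical stack M_cent ∈ R^{Nd × q}. Define B^{ESCI} = diag(ω_i^{-1} P_i^{(1)}) + diag(P_i^{(ind)}) + M_cent Q M_centᵀ and B^{SCI} = diag(ω_i^{-1} (P_i^{(1)} + M_i Q M_iᵀ)) + diag(P_i^{(ind)}), corresponding to ESCI exploiting the common noise versus SCI grouping the common-noise terms with the unknown-correlation component. Then B^{ESCI} ⪯ B^{SCI}, and consequently (Hᵀ (B^{ESCI})^{-1} H)^{-1} ⪯ (Hᵀ (B^{SCI})^{-1} H)^{-1}. -/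

import Mathlib

open Matrix

/-- The `Nd × d` matrix `1_N ⊗ I_d`: the vertical stack of `N` copies of `I_d`. -/
noncomputable def Hstack (d N : ℕ) : Matrix (Fin d × Fin N) (Fin d) ℝ :=
  fun p l => if p.1 = l then 1 else 0

namespace Matrix

theorem dotProduct_blockDiagonal_mulVec {R m o : Type*} [NonUnitalSemiring R] [Fintype m]
    [Fintype o] [DecidableEq o] (A : o → Matrix m m R) (x y : m × o → R) :
    x ⬝ᵥ (blockDiagonal A *ᵥ y) = ∑ k, (fun i => x (i, k)) ⬝ᵥ (A k *ᵥ fun i => y (i, k)) := by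
  simp only [dotProduct, mulVec, Fintype.sum_prod_type_right, blockDiagonal_apply, ite_mul,
    zero_mul]
  refine Finset.sum_congr rfl fun k _ => Finset.sum_congr rfl fun i _ => ?_
  rw [Finset.sum_eq_single k] <;> simp +contextual [eq_comm]

theorem IsHermitian.blockDiagonal {R m o : Type*} [AddMonoid R] [StarAddMonoid R]
    [DecidableEq o] {A : o → Matrix m m R} (hA : ∀ k, (A k).IsHermitian) :
    (blockDiagonal A).IsHermitian := by
  rw [IsHermitian, blockDiagonal_conjTranspose]
  exact congrArg _ (funext hA)

theorem PosSemidef.blockDiagonal {m o : Type*} [Fintype m] [Fintype o] [DecidableEq o]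
    {A : o → Matrix m m ℝ} (hA : ∀ k, (A k).PosSemidef) : (blockDiagonal A).PosSemidef := by
  refine .of_dotProduct_mulVec_nonneg (.blockDiagonal fun k => (hA k).isHermitian) fun x => ?_
  rw [dotProduct_blockDiagonal_mulVec]
  exact Finset.sum_nonneg fun k _ => (hA k).dotProduct_mulVec_nonneg fun i => x (i, k)

theorem PosDef.blockDiagonal {m o : Type*} [Fintype m] [Fintype o] [DecidableEq o]
    {A : o → Matrix m m ℝ} (hA : ∀ k, (A k).PosDef) : (blockDiagonal A).PosDef := by
  refine .of_dotProduct_mulVec_pos (.blockDiagonal fun k => (hA k).isHermitian) fun x hx => ?_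
  rw [dotProduct_blockDiagonal_mulVec]
  obtain ⟨⟨i, k⟩, hik⟩ := Function.ne_iff.mp hx
  exact Finset.sum_pos'
    (fun k _ => (hA k).posSemidef.dotProduct_mulVec_nonneg fun i => x (i, k))
    ⟨k, Finset.mem_univ k, (hA k).dotProduct_mulVec_pos (x := fun i => x (i, k))
      (Function.ne_iff.mpr ⟨i, hik⟩)⟩

/-- Inversion reverses the Loewner order on positive definite matrices. -/
theorem PosDef.posSemidef_inv_sub_inv {n : Type*} [Fintype n] [DecidableEq n]
    {A B : Matrix n n ℝ} (hA : A.PosDef) (hB : B.PosDef) (hAB : (B - A).PosSemidef) :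
    (A⁻¹ - B⁻¹).PosSemidef := by
  let := hA.isUnit.invertible
  let := hB.isUnit.invertible
  let := hA.inv.isUnit.invertible
  have h := (PosDef.fromBlocks₁₁ (1 : Matrix n n ℝ) A⁻¹ hB).symm.trans
    (PosDef.fromBlocks₂₂ B 1 hA.inv)
  simp only [conjTranspose_one, one_mul, mul_one, inv_inv_of_invertible] at h
  exact h.mpr hAB

/-- Jensen's inequality for `X ↦ X Q Xᵀ`, in the Loewner order. -/
theorem PosSemidef.sum_inv_smul_sub {m n ι : Type*} [Fintype m] [Fintype n] [Fintype ι]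
    {Q : Matrix n n ℝ} (hQ : Q.PosSemidef) {w : ι → ℝ} (hw : ∀ i, 0 < w i)
    (hsum : ∑ i, w i = 1) (E : ι → Matrix m n ℝ) :
    (∑ i, (w i)⁻¹ • (E i * Q * (E i)ᵀ) - (∑ i, E i) * Q * (∑ i, E i)ᵀ).PosSemidef := by
  set S := ∑ i, E i with hS
  have key : ∑ i, (w i)⁻¹ • (E i * Q * (E i)ᵀ) - S * Q * Sᵀ =
      ∑ i, (w i)⁻¹ • ((E i - w i • S) * Q * (E i - w i • S)ᵀ) := by
    have expand (i : ι) : (w i)⁻¹ • ((E i - w i • S) * Q * (E i - w i • S)ᵀ) =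
        (w i)⁻¹ • (E i * Q * (E i)ᵀ) - E i * Q * Sᵀ - S * Q * (E i)ᵀ +
          w i • (S * Q * Sᵀ) := by
      simp only [transpose_sub, transpose_smul, Matrix.sub_mul, Matrix.mul_sub, Matrix.smul_mul,
        Matrix.mul_smul, smul_sub, smul_smul, inv_mul_cancel₀ (hw i).ne',
        inv_mul_cancel_left₀ (hw i).ne', one_smul]
      abel
    simp only [expand, Finset.sum_add_distrib, Finset.sum_sub_distrib, ← Finset.sum_smul, hsum,
      ← Matrix.sum_mul, ← Matrix.mul_sum, ← transpose_sum, ← hS, one_smul]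
    abel
  rw [key]
  refine posSemidef_sum _ fun i _ => .smul ?_ (inv_pos.mpr (hw i)).le
  simpa only [conjTranspose_eq_transpose_of_trivial] using
    hQ.mul_mul_conjTranspose_same (E i - w i • S)

/-- A positive semidefinite congruence of stacked blocks is dominated by its reweighted block
diagonal. -/
theorem PosSemidef.blockDiagonal_inv_smul_sub {m n o : Type*} [Fintype m] [Fintype n] [Fintype o]
    [DecidableEq o] {Q : Matrix n n ℝ} (hQ : Q.PosSemidef) {w : o → ℝ} (hw : ∀ i, 0 < w i)
    (hsum : ∑ i, w i = 1) (M : o → Matrix m n ℝ) :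
    (Matrix.blockDiagonal (fun i => (w i)⁻¹ • (M i * Q * (M i)ᵀ)) -
      of (fun (p : m × o) j => M p.2 p.1 j) * Q *
        (of fun (p : m × o) j => M p.2 p.1 j)ᵀ).PosSemidef := by
  let E (i : o) : Matrix (m × o) n ℝ := of fun p j => if p.2 = i then M i p.1 j else 0
  have hE : ∑ i, E i = of fun (p : m × o) j => M p.2 p.1 j := by
    ext p j
    simp [E, sum_apply]
  have hdiag : Matrix.blockDiagonal (fun i => (w i)⁻¹ • (M i * Q * (M i)ᵀ)) =
      ∑ i, (w i)⁻¹ • (E i * Q * (E i)ᵀ) := by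
    ext ⟨a, k⟩ ⟨b, l⟩
    rw [sum_apply, Finset.sum_eq_single k]
    · by_cases h : k = l <;> simp [E, blockDiagonal_apply, mul_apply, h, eq_comm]
    · intro i _ hi
      simp [E, mul_apply, hi.symm]
    · simp
  rw [hdiag, ← hE]
  exact hQ.sum_inv_smul_sub hw hsum E

end Matrix

theorem Hstack_mulVec (d N : ℕ) (x : Fin d → ℝ) : Hstack d N *ᵥ x = fun p => x p.1 := by
  ext p
  simp [Hstack, mulVec, dotProduct]

theorem Hstack_mulVec_injective (d : ℕ) {N : ℕ} (hN : 1 ≤ N) :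
    Function.Injective (Hstack d N).mulVec := by
  intro x y h
  simp only [Hstack_mulVec] at h
  exact funext fun i => congrFun h (i, ⟨0, hN⟩)

/-- The fused bound `(Hᵀ B⁻¹ H)⁻¹` is monotone in `B`. -/
theorem fused_bound_mono {m n : Type*} [Fintype m] [DecidableEq m] [Fintype n] [DecidableEq n]
    {H : Matrix m n ℝ} (hH : Function.Injective H.mulVec) {A B : Matrix m m ℝ} (hA : A.PosDef)
    (hB : B.PosDef) (hAB : (B - A).PosSemidef) :
    ((Hᵀ * B⁻¹ * H)⁻¹ - (Hᵀ * A⁻¹ * H)⁻¹).PosSemidef := by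
  rw [← conjTranspose_eq_transpose_of_trivial]
  refine (hB.inv.conjTranspose_mul_mul_same hH).posSemidef_inv_sub_inv
    (hA.inv.conjTranspose_mul_mul_same hH) ?_
  rw [← Matrix.sub_mul, ← Matrix.mul_sub]
  exact (hA.posSemidef_inv_sub_inv hB hAB).conjTranspose_mul_mul_same H

/-- In the common-noise setting, the ESCI centralized bound is dominated by the SCI one,
hence the ESCI fused bound is tighter than the SCI fused bound. -/
theorem ESCI_tighter_than_SCI {d N q : ℕ} (hd : 1 ≤ d) (hN : 1 ≤ N) (hq : 1 ≤ q)
    (ω : Fin N → ℝ) (hω : ∀ i, 0 < ω i) (hsum : ∑ i, ω i = 1)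
    (P1 : Fin N → Matrix (Fin d) (Fin d) ℝ) (hP1 : ∀ i, (P1 i).PosDef)
    (Pind : Fin N → Matrix (Fin d) (Fin d) ℝ) (hPind : ∀ i, (Pind i).PosSemidef)
    (Q : Matrix (Fin q) (Fin q) ℝ) (hQ : Q.PosDef)
    (M : Fin N → Matrix (Fin d) (Fin q) ℝ) :
    let Mcent : Matrix (Fin d × Fin N) (Fin q) ℝ := fun p j => M p.2 p.1 j
    let BESCI := Matrix.blockDiagonal (fun i => (ω i)⁻¹ • P1 i) +
      Matrix.blockDiagonal Pind + Mcent * Q * Mcentᵀ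
    let BSCI := Matrix.blockDiagonal (fun i => (ω i)⁻¹ • (P1 i + M i * Q * (M i)ᵀ)) +
      Matrix.blockDiagonal Pind
    (BSCI - BESCI).PosSemidef ∧
    (((Hstack d N)ᵀ * BSCI⁻¹ * Hstack d N)⁻¹ -
      ((Hstack d N)ᵀ * BESCI⁻¹ * Hstack d N)⁻¹).PosSemidef := by
  intro Mcent BESCI BSCI
  have hsub : BSCI - BESCI =
      blockDiagonal (fun i => (ω i)⁻¹ • (M i * Q * (M i)ᵀ)) - Mcent * Q * Mcentᵀ := by
    have hadd : blockDiagonal (fun i => (ω i)⁻¹ • (P1 i + M i * Q * (M i)ᵀ)) =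
        blockDiagonal (fun i => (ω i)⁻¹ • P1 i) +
          blockDiagonal (fun i => (ω i)⁻¹ • (M i * Q * (M i)ᵀ)) := by
      rw [← blockDiagonal_add]
      exact congrArg _ (funext fun i => smul_add _ _ _)
    simp only [BSCI, BESCI, hadd]
    abel
  have hle : (BSCI - BESCI).PosSemidef :=
    hsub ▸ hQ.posSemidef.blockDiagonal_inv_smul_sub hω hsum M
  have hcent : (Mcent * Q * Mcentᵀ).PosSemidef := by
    simpa only [conjTranspose_eq_transpose_of_trivial] using
      hQ.posSemidef.mul_mul_conjTranspose_same Mcent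
  have hESCI : BESCI.PosDef :=
    ((PosDef.blockDiagonal fun i => (hP1 i).smul (inv_pos.mpr (hω i))).add_posSemidef
      (.blockDiagonal hPind)).add_posSemidef hcent
  have hSCI : BSCI.PosDef := by
    simpa only [add_sub_cancel] using hESCI.add_posSemidef hle
  exact ⟨hle, fused_bound_mono (Hstack_mulVec_injective d hN) hESCI hSCI hle⟩
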